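/- arXiv:math/0606755 — 2 statements merged into one kernel-verified Lean document; each statement's English description precedes it below -/
import Mathlib

section
/- Let Z and Y be independent standard normal real random variables, let r, s ∈ ℝ, and let j ∈ ℕ. Then, with i = √(−1), the complex moment E[(r Z + i s Y)^{2j}] equals ((2j)!/(2^j j!)) · (r² − s²)^j, and E[(r Z + i s Y)^{2j+1}] = 0. -/
open MeasureTheory ProbabilityTheory
open scoped ENNReal

/-- Functions with finite moments of all orders are closed under multiplication. -/
lemma memLp_mul_of_forall_memLp {α : Type*} [MeasurableSpace α] {μ : Measure α} {f g : α → ℂ}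
    (hf : ∀ p : ℝ≥0∞, p ≠ ∞ → MemLp f p μ) (hg : ∀ p : ℝ≥0∞, p ≠ ∞ → MemLp g p μ)
    (p : ℝ≥0∞) (hp : p ≠ ∞) : MemLp (fun x ↦ f x * g x) p μ := by
  have h2p : 2 * p ≠ ∞ := ENNReal.mul_ne_top (by simp) hp
  have : ENNReal.HolderTriple (2 * p) (2 * p) p := ⟨by
    rw [ENNReal.mul_inv (by simp) (by simp), ← add_mul, ENNReal.inv_two_add_inv_two, one_mul]⟩
  exact (hg _ h2p).mul' (hf _ h2p)

/-- Functions with finite moments of all orders are closed under natural powers. -/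
lemma memLp_pow_of_forall_memLp {α : Type*} [MeasurableSpace α] {μ : Measure α}
    [IsFiniteMeasure μ] {f : α → ℂ} (hf : ∀ p : ℝ≥0∞, p ≠ ∞ → MemLp f p μ) (n : ℕ) :
    ∀ p : ℝ≥0∞, p ≠ ∞ → MemLp (fun x ↦ f x ^ n) p μ := by
  induction n with
  | zero => intro p _; simpa using memLp_const (1 : ℂ)
  | succ n ih => simpa only [pow_succ] using memLp_mul_of_forall_memLp ih hf

lemma memLp_ofReal_gaussianReal (p : ℝ≥0∞) (hp : p ≠ ∞) :
    MemLp (fun x : ℝ ↦ (x : ℂ)) p (gaussianReal 0 1) :=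
  (memLp_id_gaussianReal' p hp).ofReal

lemma memLp_linear_gaussianReal (a c : ℂ) (p : ℝ≥0∞) (hp : p ≠ ∞) :
    MemLp (fun x : ℝ ↦ a * x + c) p (gaussianReal 0 1) :=
  ((memLp_ofReal_gaussianReal p hp).const_mul a).add (memLp_const c)

lemma integrable_gaussianReal_iff_integrable_mul_gaussianPDFReal {f : ℝ → ℂ} :
    Integrable f (gaussianReal 0 1) ↔
      Integrable (fun x ↦ f x * (gaussianPDFReal 0 1 x : ℂ)) := by
  rw [gaussianReal_of_var_ne_zero _ one_ne_zero, integrable_withDensity_iff_integrable_smul'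
    (measurable_gaussianPDF 0 1) (ae_of_all _ fun _ ↦ gaussianPDF_lt_top)]
  simp only [toReal_gaussianPDF, Complex.real_smul, mul_comm]

lemma hasDerivAt_gaussianPDFReal_zero_one (x : ℝ) :
    HasDerivAt (gaussianPDFReal 0 1) (-x * gaussianPDFReal 0 1 x) x := by
  have h : HasDerivAt (fun y : ℝ ↦ -(y - 0) ^ 2 / (2 * 1)) (-x) x := by
    convert! ((((hasDerivAt_id x).sub_const 0).pow 2).neg.div_const (2 * 1)) using 1
    simp
    ring
  rw [gaussianPDFReal_def]
  convert! h.exp.const_mul (√(2 * Real.pi * 1))⁻¹ using 1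
  simp
  ring

/-- Gaussian integration by parts. -/
lemma integral_mul_gaussianReal_eq_integral_deriv {f f' : ℝ → ℂ}
    (hf : ∀ x, HasDerivAt f (f' x) x) (hfint : Integrable f (gaussianReal 0 1))
    (hxf : Integrable (fun x : ℝ ↦ (x : ℂ) * f x) (gaussianReal 0 1))
    (hf' : Integrable f' (gaussianReal 0 1)) :
    ∫ x, (x : ℂ) * f x ∂gaussianReal 0 1 = ∫ x, f' x ∂gaussianReal 0 1 := by
  rw [integrable_gaussianReal_iff_integrable_mul_gaussianPDFReal] at hfint hxf hf'
  have key := integral_mul_deriv_eq_deriv_mul_of_integrable (u := f) (u' := f')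
    (v := fun x ↦ (gaussianPDFReal 0 1 x : ℂ))
    (v' := fun x ↦ ((-x * gaussianPDFReal 0 1 x : ℝ) : ℂ))
    (fun x _ ↦ hf x) (fun x _ ↦ (hasDerivAt_gaussianPDFReal_zero_one x).ofReal_comp)
    (hxf.neg.congr (ae_of_all _ fun x ↦ by simp; ring)) hf' hfint
  rw [integral_gaussianReal_eq_integral_smul one_ne_zero,
    integral_gaussianReal_eq_integral_smul one_ne_zero]
  simp only [Complex.real_smul]
  rw [← neg_inj, ← integral_neg]
  simp only [mul_comm (f' _)] at key
  rw [← key]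
  congr with x
  push_cast
  ring

lemma integral_mul_linear_pow_gaussianReal (a c : ℂ) (n : ℕ) :
    ∫ x, (x : ℂ) * (a * x + c) ^ (n + 1) ∂gaussianReal 0 1 =
      (n + 1) * a * ∫ x : ℝ, (a * x + c) ^ n ∂gaussianReal 0 1 := by
  have hpow := memLp_pow_of_forall_memLp (memLp_linear_gaussianReal a c)
  rw [← integral_const_mul]
  refine integral_mul_gaussianReal_eq_integral_deriv (fun x ↦ ?_)
    (memLp_one_iff_integrable.1 (hpow (n + 1) 1 (by simp)))
    (memLp_one_iff_integrable.1
      (memLp_mul_of_forall_memLp memLp_ofReal_gaussianReal (hpow (n + 1)) 1 (by simp)))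
    ((memLp_one_iff_integrable.1 (hpow n 1 (by simp))).const_mul _)
  convert! (((hasDerivAt_id x).ofReal_comp.const_mul a).add_const c).pow (n + 1) using 1
  simp
  ring

lemma memLp_linear_prod_gaussianReal (a b : ℂ) (p : ℝ≥0∞) (hp : p ≠ ∞) :
    MemLp (fun x : ℝ × ℝ ↦ a * x.1 + b * x.2) p ((gaussianReal 0 1).prod (gaussianReal 0 1)) :=
  (((memLp_ofReal_gaussianReal p hp).comp_fst _).const_mul a).add
    (((memLp_ofReal_gaussianReal p hp).comp_snd _).const_mul b)

lemma integral_fst_mul_linear_pow_prod_gaussianReal (a b : ℂ) (n : ℕ) :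
    ∫ x : ℝ × ℝ, (x.1 : ℂ) * (a * x.1 + b * x.2) ^ (n + 1)
        ∂(gaussianReal 0 1).prod (gaussianReal 0 1) =
      (n + 1) * a * ∫ x : ℝ × ℝ, (a * x.1 + b * x.2) ^ n
        ∂(gaussianReal 0 1).prod (gaussianReal 0 1) := by
  have hpow := memLp_pow_of_forall_memLp (memLp_linear_prod_gaussianReal a b)
  rw [integral_prod_symm _ (memLp_one_iff_integrable.1 (memLp_mul_of_forall_memLp
      (fun p hp ↦ (memLp_ofReal_gaussianReal p hp).comp_fst _) (hpow (n + 1)) 1 (by simp))),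
    integral_prod_symm _ (memLp_one_iff_integrable.1 (hpow n 1 (by simp)))]
  simp only [integral_mul_linear_pow_gaussianReal, integral_const_mul]

lemma integral_snd_mul_linear_pow_prod_gaussianReal (a b : ℂ) (n : ℕ) :
    ∫ x : ℝ × ℝ, (x.2 : ℂ) * (a * x.1 + b * x.2) ^ (n + 1)
        ∂(gaussianReal 0 1).prod (gaussianReal 0 1) =
      (n + 1) * b * ∫ x : ℝ × ℝ, (a * x.1 + b * x.2) ^ n
        ∂(gaussianReal 0 1).prod (gaussianReal 0 1) := by
  rw [← integral_prod_swap, ← integral_prod_swap (f := fun x : ℝ × ℝ ↦ (a * x.1 + b * x.2) ^ n)]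
  simpa only [Prod.fst_swap, Prod.snd_swap, add_comm] using
    integral_fst_mul_linear_pow_prod_gaussianReal b a n

/-- Two-step recursion for the moments of a complex linear combination of two independent
standard Gaussians. -/
lemma integral_linear_pow_add_two_prod_gaussianReal (a b : ℂ) (n : ℕ) :
    ∫ x : ℝ × ℝ, (a * x.1 + b * x.2) ^ (n + 2) ∂(gaussianReal 0 1).prod (gaussianReal 0 1) =
      (n + 1) * (a ^ 2 + b ^ 2) * ∫ x : ℝ × ℝ, (a * x.1 + b * x.2) ^ n
        ∂(gaussianReal 0 1).prod (gaussianReal 0 1) := by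
  have hpow := memLp_pow_of_forall_memLp (memLp_linear_prod_gaussianReal a b) (n + 1)
  have h₁ := memLp_one_iff_integrable.1 (memLp_mul_of_forall_memLp
      (fun p hp ↦ (memLp_ofReal_gaussianReal p hp).comp_fst _) hpow 1 (by simp))
  have h₂ := memLp_one_iff_integrable.1 (memLp_mul_of_forall_memLp
      (fun p hp ↦ (memLp_ofReal_gaussianReal p hp).comp_snd _) hpow 1 (by simp))
  calc _ = ∫ x : ℝ × ℝ, (a * ((x.1 : ℂ) * (a * x.1 + b * x.2) ^ (n + 1)) +
          b * ((x.2 : ℂ) * (a * x.1 + b * x.2) ^ (n + 1)))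
          ∂(gaussianReal 0 1).prod (gaussianReal 0 1) := by
        congr with x
        ring
    _ = _ := by
        rw [integral_add (h₁.const_mul a) (h₂.const_mul b), integral_const_mul,
          integral_const_mul, integral_fst_mul_linear_pow_prod_gaussianReal,
          integral_snd_mul_linear_pow_prod_gaussianReal]
        ring

lemma integral_linear_prod_gaussianReal (a b : ℂ) :
    ∫ x : ℝ × ℝ, (a * x.1 + b * x.2) ∂(gaussianReal 0 1).prod (gaussianReal 0 1) = 0 := by
  have h : Integrable (fun x : ℝ ↦ (x : ℂ)) (gaussianReal 0 1) :=
    memLp_one_iff_integrable.1 (memLp_ofReal_gaussianReal 1 (by simp))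
  rw [integral_add ((h.comp_fst _).const_mul a) ((h.comp_snd _).const_mul b),
    integral_const_mul, integral_const_mul, integral_fun_fst (fun x : ℝ ↦ (x : ℂ)),
    integral_fun_snd (fun x : ℝ ↦ (x : ℂ)), integral_complex_ofReal, integral_id_gaussianReal]
  simp

lemma integral_linear_pow_odd_prod_gaussianReal (a b : ℂ) (j : ℕ) :
    ∫ x : ℝ × ℝ, (a * x.1 + b * x.2) ^ (2 * j + 1)
      ∂(gaussianReal 0 1).prod (gaussianReal 0 1) = 0 := by
  induction j with
  | zero => simpa using integral_linear_prod_gaussianReal a b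
  | succ j ih =>
    rw [show 2 * (j + 1) + 1 = 2 * j + 1 + 2 by ring,
      integral_linear_pow_add_two_prod_gaussianReal, ih, mul_zero]

lemma integral_linear_pow_even_prod_gaussianReal (a b : ℂ) (j : ℕ) :
    ∫ x : ℝ × ℝ, (a * x.1 + b * x.2) ^ (2 * j) ∂(gaussianReal 0 1).prod (gaussianReal 0 1) =
      ((2 * j).factorial : ℂ) / (2 ^ j * j.factorial) * (a ^ 2 + b ^ 2) ^ j := by
  induction j with
  | zero => simp
  | succ j ih =>
    have hj : ((j : ℂ) + 1) ≠ 0 := by exact_mod_cast j.succ_ne_zero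
    have hj' : (j.factorial : ℂ) ≠ 0 := by exact_mod_cast j.factorial_ne_zero
    rw [show 2 * (j + 1) = 2 * j + 2 by ring,
      integral_linear_pow_add_two_prod_gaussianReal, ih]
    simp only [Nat.factorial_succ]
    push_cast
    field_simp
    ring

/-- For independent standard normal real random variables `Z, Y`, reals `r, s` and `j ∈ ℕ`,
the complex moment `E[(r Z + i s Y)^{2j}]` equals `((2j)!/(2^j j!))·(r² − s²)^j`, and
`E[(r Z + i s Y)^{2j+1}] = 0`. -/
theorem stmt_9 {Ω : Type*} [MeasurableSpace Ω] (P : Measure Ω) [IsProbabilityMeasure P]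
    (Z Y : Ω → ℝ) (hZmeas : Measurable Z) (hYmeas : Measurable Y)
    (hZ : P.map Z = gaussianReal 0 1) (hY : P.map Y = gaussianReal 0 1)
    (hindep : IndepFun Z Y P) (r s : ℝ) (j : ℕ) :
    (∫ ω, ((r * Z ω : ℂ) + Complex.I * s * Y ω) ^ (2 * j) ∂P =
      ((((2 * j).factorial : ℝ) / (2 ^ j * j.factorial) * (r ^ 2 - s ^ 2) ^ j : ℝ) : ℂ)) ∧
    (∫ ω, ((r * Z ω : ℂ) + Complex.I * s * Y ω) ^ (2 * j + 1) ∂P = 0) := by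
  have hmap : P.map (fun ω ↦ (Z ω, Y ω)) = (gaussianReal 0 1).prod (gaussianReal 0 1) := by
    rw [hindep.map_prod_eq_prod_map_map hZmeas.aemeasurable hYmeas.aemeasurable, hZ, hY]
  have hmoment (n : ℕ) : ∫ ω, ((r * Z ω : ℂ) + Complex.I * s * Y ω) ^ n ∂P =
      ∫ x : ℝ × ℝ, (r * x.1 + Complex.I * s * x.2) ^ n
        ∂(gaussianReal 0 1).prod (gaussianReal 0 1) := by
    rw [← hmap, integral_map (hZmeas.prodMk hYmeas).aemeasurable
      (Measurable.aestronglyMeasurable (by fun_prop))]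
  refine ⟨?_, ?_⟩
  · rw [hmoment, integral_linear_pow_even_prod_gaussianReal, mul_pow, Complex.I_sq]
    push_cast
    ring
  · rw [hmoment, integral_linear_pow_odd_prod_gaussianReal]
end

section
/- Let f ∈ ℝ[X₀, …, Xₙ] be a homogeneous polynomial of degree d, let V = (V₁, …, Vₙ) ∈ ℝⁿ be a unit vector, and let q := (1, 0, …, 0) ∈ ℝ^{n+1}. Define g : ℝ → ℝ by g(t) := (1 + t²)^{−d/2} · f(1, t V₁, …, t Vₙ). Then g is twice differentiable at 0 and g''(0) = Σ_{k,ℓ=1}^{n} (∂²f/∂X_k∂X_ℓ)(q) · V_k V_ℓ − d · f(q). (Equivalently: the second derivative D²f(q) of the restriction of f to the unit sphere Sⁿ, at the point q and identifying T_q Sⁿ with ℝⁿ, is given by the matrix (∂²_{kℓ} f(q))_{1≤k,ℓ≤n} − d f(q) Iₙ.) -/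
open MvPolynomial

/-- Chain rule for a polynomial evaluated along a curve. -/
theorem MvPolynomial.hasDerivAt_eval_comp {σ : Type*} [Fintype σ] (p : MvPolynomial σ ℝ)
    {c : ℝ → σ → ℝ} {c' : σ → ℝ} {t : ℝ} (hc : ∀ i, HasDerivAt (fun s => c s i) (c' i) t) :
    HasDerivAt (fun s => eval (c s) p) (∑ i, eval (c t) (pderiv i p) * c' i) t := by
  classical
  induction p using MvPolynomial.induction_on with
  | C a => simpa using hasDerivAt_const t a
  | add p q hp hq =>
    simpa [add_mul, Finset.sum_add_distrib] using hp.fun_add hq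
  | mul_X p j hp =>
    simp only [map_mul, eval_X]
    refine (hp.mul (hc j)).congr_deriv ?_
    simp [Derivation.leibniz, pderiv_X, Pi.single_apply, add_mul, Finset.sum_add_distrib,
      Finset.sum_mul, apply_ite]
    rw [add_comm]
    exact congrArg _ (Finset.sum_congr rfl fun i _ => by ring)

/-- Derivative of a polynomial along the line `t ↦ (1, t V₁, …, t Vₙ)`. -/
theorem MvPolynomial.hasDerivAt_eval_cons_one_mul {n : ℕ}
    (p : MvPolynomial (Fin (n + 1)) ℝ) (V : Fin n → ℝ) (t : ℝ) :
    HasDerivAt (fun s => eval (Fin.cons 1 fun k => s * V k : Fin (n + 1) → ℝ) p)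
      (∑ k, eval (Fin.cons 1 fun k => t * V k : Fin (n + 1) → ℝ) (pderiv k.succ p) * V k) t := by
  have hc (i : Fin (n + 1)) : HasDerivAt
      (fun s => (Fin.cons 1 fun k => s * V k : Fin (n + 1) → ℝ) i)
      ((Fin.cons 0 V : Fin (n + 1) → ℝ) i) t := by
    refine Fin.cases ?_ (fun k => ?_) i
    · simpa using hasDerivAt_const t (1 : ℝ)
    · simpa using (hasDerivAt_id t).mul_const (V k)
  simpa [Fin.sum_univ_succ] using p.hasDerivAt_eval_comp hc

theorem hasDerivAt_one_add_sq_rpow (a t : ℝ) :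
    HasDerivAt (fun s : ℝ => (1 + s ^ 2) ^ a) (2 * a * t * (1 + t ^ 2) ^ (a - 1)) t := by
  have h : HasDerivAt (fun s : ℝ => 1 + s ^ 2) (2 * t) t := by
    simpa using (hasDerivAt_pow 2 t).const_add 1
  refine (h.rpow_const (p := a) (Or.inl (by positivity))).congr_deriv ?_
  ring

/-- Let `f` be a homogeneous polynomial of degree `d` in `X₀,…,Xₙ`, `V ∈ ℝⁿ` a unit vector,
`q = (1,0,…,0)`, and `g(t) := (1+t²)^{−d/2}·f(1, tV₁, …, tVₙ)`. Then `g` is twice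
differentiable at `0` and `g''(0) = Σ_{k,ℓ} ∂²f/∂X_k∂X_ℓ(q)·V_kV_ℓ − d·f(q)`. -/
theorem stmt_16 (n d : ℕ) (f : MvPolynomial (Fin (n + 1)) ℝ) (hf : f.IsHomogeneous d)
    (V : Fin n → ℝ) (hV : ∑ k, V k ^ 2 = 1) :
    let q : Fin (n + 1) → ℝ := Fin.cons 1 fun _ => 0
    let g : ℝ → ℝ := fun t =>
      (1 + t ^ 2) ^ (-(d : ℝ) / 2) * eval (Fin.cons 1 fun k => t * V k) f
    (∀ t, DifferentiableAt ℝ g t) ∧ DifferentiableAt ℝ (deriv g) 0 ∧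
      deriv (deriv g) 0 =
        (∑ k, ∑ l, eval q (pderiv k.succ (pderiv l.succ f)) * V k * V l) -
          (d : ℝ) * eval q f := by
  intro q g
  have hg (t : ℝ) := (hasDerivAt_one_add_sq_rpow (-(d : ℝ) / 2) t).mul
    (f.hasDerivAt_eval_cons_one_mul V t)
  have hg' : deriv g = _ := funext fun t => (hg t).deriv
  have hF := HasDerivAt.fun_sum (u := Finset.univ) fun l _ =>
    ((pderiv (Fin.succ l) f).hasDerivAt_eval_cons_one_mul V 0).mul_const (V l)
  have hlin : HasDerivAt (fun t : ℝ => 2 * (-(d : ℝ) / 2) * t) (-d) 0 := by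
    refine ((hasDerivAt_id (0 : ℝ)).const_mul (2 * (-(d : ℝ) / 2))).congr_deriv ?_
    ring
  have h2 : HasDerivAt (deriv g)
      ((∑ k, ∑ l, eval q (pderiv k.succ (pderiv l.succ f)) * V k * V l) -
        (d : ℝ) * eval q f) 0 := by
    rw [hg']
    refine (((hlin.mul (hasDerivAt_one_add_sq_rpow (-(d : ℝ) / 2 - 1) 0)).mul
      (f.hasDerivAt_eval_cons_one_mul V 0)).add
      ((hasDerivAt_one_add_sq_rpow (-(d : ℝ) / 2) 0).mul hF)).congr_deriv ?_
    rw [Finset.sum_comm]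
    simp [q, Finset.sum_mul]
    ring
  exact ⟨fun t => (hg t).differentiableAt, h2.differentiableAt, h2.deriv⟩
end
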